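/- Let 𝒯 be a finite undirected tree, w : V(𝒯) → ℝ≥0 a weight function, and let T be an optimal search tree on 𝒯, i.e., cost_w(T) = OPT(𝒯,w). Then T is a 2/3-centroid tree of (𝒯,w): for every x ∈ V(𝒯), x is a 2/3-centroid of the subgraph 𝒯[V(T_x)]. -/

import Mathlib

open Filter Topology

universe u

variable {V : Type u}

/-- Rooted trees with vertices labelled by elements of `V`. -/
inductive RTree (V : Type u) : Type u where
  | node : V → List (RTree V) → RTree V

namespace RTree

/-- The root of a rooted tree. -/
def root : RTree V → V
  | node r _ => r

/-- The subtrees rooted at the children of the root. -/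
def children : RTree V → List (RTree V)
  | node _ ts => ts

/-- The list of pairs `(v, path from the root to v)` over all vertices `v` of the tree. -/
def pathsFrom : RTree V → List (V × List V)
  | node r ts =>
      (r, [r]) ::
        (ts.attach.map fun t => (t.1.pathsFrom.map fun p => (p.1, r :: p.2))).flatten
  decreasing_by
    simp only [RTree.node.sizeOf_spec]
    have := List.sizeOf_lt_of_mem t.2
    omega

/-- The vertex set of a rooted tree. -/
def vertSet (T : RTree V) : Set V := {v | ∃ p ∈ T.pathsFrom, p.1 = v}

/-- `Path_T(v)`: the set of vertices on the path in `T` from the root to `v`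
(including both endpoints). -/
def pathSet (T : RTree V) (v : V) : Set V := {x | ∃ p ∈ T.pathsFrom, p.1 = v ∧ x ∈ p.2}

/-- The depth of a vertex `v` in `T`; the root has depth 1. -/
noncomputable def depth (T : RTree V) (v : V) : ℕ := (T.pathSet v).ncard

/-- All subtrees of a rooted tree (including the tree itself). -/
def allSubtrees : RTree V → List (RTree V)
  | node r ts => node r ts :: (ts.attach.map fun t => t.1.allSubtrees).flatten
  decreasing_by
    simp only [RTree.node.sizeOf_spec]
    have := List.sizeOf_lt_of_mem t.2
    omega

/-- Two rooted trees are equivalent (represent the same search tree) if they have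
the same root-to-vertex paths. -/
def Equiv (T₁ T₂ : RTree V) : Prop := ∀ v, T₁.pathSet v = T₂.pathSet v

end RTree

/-- `x` and `y` are joined by a walk of `G` staying inside `s`. -/
def ReachIn (G : SimpleGraph V) (s : Set V) (x y : V) : Prop :=
  ∃ p : G.Walk x y, ∀ v ∈ p.support, v ∈ s

/-- The connected component of `x` in the subgraph of `G` induced by `s`. -/
def compIn (G : SimpleGraph V) (s : Set V) (x : V) : Set V := {y | ReachIn G s x y}

/-- The set of connected components of the subgraph of `G` induced by `s`. -/
def comps (G : SimpleGraph V) (s : Set V) : Set (Set V) := {c | ∃ x ∈ s, c = compIn G s x}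

/-- `s` induces a (nonempty) connected subgraph of `G`. -/
def ConnIn (G : SimpleGraph V) (s : Set V) : Prop :=
  s.Nonempty ∧ ∀ x ∈ s, ∀ y ∈ s, ReachIn G s x y

/-- The total weight of a set of vertices. -/
noncomputable def wsum (w : V → ℝ) (s : Set V) : ℝ := ∑ᶠ x ∈ s, w x

/-- `IsSearchTree G s T`: `T` is a search tree on the subgraph of `G` induced by `s`.
Its root `r` is a vertex of `s`, its vertex set is `s`, and the subtrees rooted at the
children of `r` are search trees on the connected components of the induced subgraph
on `s \ {r}` (one subtree for each component). -/
inductive IsSearchTree (G : SimpleGraph V) : Set V → RTree V → Prop where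
  | node {s : Set V} {r : V} {ts : List (RTree V)} :
      r ∈ s →
      (RTree.node r ts).vertSet = s →
      (∀ t ∈ ts, IsSearchTree G (compIn G (s \ {r}) t.root) t) →
      ts.Pairwise (fun t₁ t₂ => compIn G (s \ {r}) t₁.root ≠ compIn G (s \ {r}) t₂.root) →
      IsSearchTree G s (RTree.node r ts)

/-- The cost of a search tree: `∑_x w(x) · depth(x)`, the root having depth 1. -/
noncomputable def cost (w : V → ℝ) (T : RTree V) : ℝ :=
  ∑ᶠ v ∈ T.vertSet, w v * (T.depth v : ℝ)

/-- The optimum cost of a search tree on the subgraph of `G` induced by `s`. -/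
noncomputable def OPT (G : SimpleGraph V) (w : V → ℝ) (s : Set V) : ℝ :=
  sInf (cost w '' {T | IsSearchTree G s T})

/-- `v` is an `α`-centroid of the subgraph of `G` induced by `s` (with weights `w`):
every connected component of the induced subgraph on `s \ {v}` has weight at most
`α` times the weight of `s`. -/
def IsAlphaCentroid (G : SimpleGraph V) (w : V → ℝ) (α : ℝ) (s : Set V) (v : V) : Prop :=
  v ∈ s ∧ ∀ x ∈ s \ {v}, wsum w (compIn G (s \ {v}) x) ≤ α * wsum w s

/-- `v` is a centroid of the subgraph of `G` induced by `s` (with weights `w`). -/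
def IsCentroid (G : SimpleGraph V) (w : V → ℝ) (s : Set V) (v : V) : Prop :=
  v ∈ s ∧ ∀ x ∈ s \ {v}, wsum w (compIn G (s \ {v}) x) ≤ wsum w s / 2

/-- `T` is an `α`-centroid tree on the subgraph of `G` induced by `s`. -/
def IsAlphaCentroidTree (G : SimpleGraph V) (w : V → ℝ) (α : ℝ) (s : Set V) (T : RTree V) :
    Prop :=
  IsSearchTree G s T ∧ ∀ t ∈ T.allSubtrees, IsAlphaCentroid G w α t.vertSet t.root

/-- `T` is a centroid tree on the subgraph of `G` induced by `s`. -/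
def IsCentroidTree (G : SimpleGraph V) (w : V → ℝ) (s : Set V) (T : RTree V) : Prop :=
  IsSearchTree G s T ∧ ∀ t ∈ T.allSubtrees, IsCentroid G w t.vertSet t.root

/-- `cent(𝒯,w)`: the maximum cost of a centroid tree. -/
noncomputable def centCost (G : SimpleGraph V) (w : V → ℝ) (s : Set V) : ℝ :=
  sSup (cost w '' {T | IsCentroidTree G w s T})

/-- `centᵅ(𝒯,w)`: the maximum cost of an `α`-centroid tree (`0` if none exists, since
`sSup ∅ = 0` in `ℝ`). -/
noncomputable def centCostA (G : SimpleGraph V) (w : V → ℝ) (α : ℝ) (s : Set V) : ℝ :=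
  sSup (cost w '' {T | IsAlphaCentroidTree G w α s T})

/-- `b` is a child of `a` in the rooted tree `T`. -/
def ChildRel (T : RTree V) (a b : V) : Prop :=
  ∃ t ∈ T.allSubtrees, t.root = a ∧ ∃ t' ∈ t.children, t'.root = b

/-- The vertices that lie on every walk of `G` from `u` to `v`; in a tree, these are the
vertices of the path from `u` to `v`. -/
def pathBetween (G : SimpleGraph V) (u v : V) : Set V := {y | ∀ p : G.Walk u v, y ∈ p.support}

/-- `s` contains the path between any two of its elements. -/
def PathClosed (G : SimpleGraph V) (s : Set V) : Prop :=
  ∀ u ∈ s, ∀ v ∈ s, pathBetween G u v ⊆ s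

/-- The ancestors of `v` in a search tree obtained by repeatedly removing a vertex of
minimum rank `f`. -/
def ancestors (G : SimpleGraph V) (f : V → ℕ) (v : V) : Set V :=
  {u | ∀ y ∈ pathBetween G u v, f u ≤ f y}

section PathBetween

variable {G : SimpleGraph V}

lemma right_mem_pathBetween (u v : V) : v ∈ pathBetween G u v := fun p => p.end_mem_support

lemma pathBetween_comm (u v : V) : pathBetween G u v = pathBetween G v u := by
  ext y
  constructor <;> intro h p <;> simpa using h p.reverse

lemma pathBetween_subset_union (u x v : V) :
    pathBetween G u v ⊆ pathBetween G u x ∪ pathBetween G x v := by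
  intro y hy
  by_contra! h
  simp only [Set.mem_union, not_or, pathBetween, Set.mem_ofPred_eq, not_forall] at h
  obtain ⟨⟨p, hp⟩, q, hq⟩ := h
  have := hy (p.append q)
  rw [SimpleGraph.Walk.mem_support_append_iff] at this
  tauto

lemma pathBetween_subset_left {u v y : V} (hy : y ∈ pathBetween G u v) :
    pathBetween G u y ⊆ pathBetween G u v := by
  classical
  intro z hz p
  exact p.support_takeUntil_subset_support (hy p) (hz (p.takeUntil y (hy p)))

lemma SimpleGraph.IsTree.pathBetween_eq_support (hG : G.IsTree) {u v : V} (p : G.Walk u v)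
    (hp : p.IsPath) : pathBetween G u v = {y | y ∈ p.support} := by
  classical
  ext y
  refine ⟨fun h => h p, fun h q => ?_⟩
  have : p = q.bypass := (hG.existsUnique_path u v).unique hp q.bypass_isPath
  exact q.support_bypass_subset_support (this ▸ h)

lemma SimpleGraph.IsTree.reachIn_iff (hG : G.IsTree) {s : Set V} {u v : V} :
    ReachIn G s u v ↔ pathBetween G u v ⊆ s := by
  constructor
  · rintro ⟨p, hp⟩ y hy
    exact hp y (hy p)
  · intro h
    obtain ⟨p, hp, -⟩ := hG.existsUnique_path u v
    rw [hG.pathBetween_eq_support p hp] at h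
    exact ⟨p, h⟩

lemma SimpleGraph.IsTree.mem_pathBetween_or_of_adj (hG : G.IsTree) {r y z : V} (h : G.Adj y z) :
    z ∈ pathBetween G r y ∨ y ∈ pathBetween G r z := by
  obtain ⟨p, hp, -⟩ := hG.existsUnique_path r y
  by_cases hz : z ∈ p.support
  · left
    rwa [hG.pathBetween_eq_support p hp]
  · right
    rw [hG.pathBetween_eq_support (p.concat h) (hp.concat hz h)]
    simp [SimpleGraph.Walk.support_concat]

/-- Any three vertices of a tree have a median. -/
lemma SimpleGraph.IsTree.exists_median (hG : G.IsTree) (r c d : V) :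
    ∃ p, p ∈ pathBetween G r c ∧ p ∈ pathBetween G r d ∧ p ∈ pathBetween G c d := by
  suffices H : ∀ a (q : G.Walk a d), {y | y ∈ q.support} ⊆ pathBetween G c d →
      a ∈ pathBetween G r c → ∃ p, p ∈ pathBetween G r c ∧ p ∈ pathBetween G r d ∧
        p ∈ pathBetween G c d by
    obtain ⟨q, hq, -⟩ := hG.existsUnique_path c d
    exact H c q (hG.pathBetween_eq_support q hq).ge (right_mem_pathBetween _ _)
  intro a q
  induction q with
  | nil => exact fun h ha => ⟨_, ha, right_mem_pathBetween _ _, right_mem_pathBetween _ _⟩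
  | @cons a b d hab q ih =>
    intro h ha
    by_cases had : a ∈ pathBetween G r d
    · exact ⟨a, ha, had, h (by simp)⟩
    by_cases hb : b ∈ pathBetween G r c
    · exact ih (fun y hy => h (by simp [Set.mem_ofPred_eq.mp hy])) hb
    have hbd : b ∈ pathBetween G r d := by
      have : b ∈ pathBetween G c d := h (by simp)
      rcases pathBetween_subset_union c r d this with h1 | h1
      · rw [pathBetween_comm] at h1
        exact absurd h1 hb
      · exact h1
    rcases hG.mem_pathBetween_or_of_adj (r := r) hab with h1 | h1
    · exact absurd (pathBetween_subset_left ha h1) hb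
    · exact absurd (pathBetween_subset_left hbd h1) had

lemma SimpleGraph.IsTree.mem_compIn (hG : G.IsTree) {s : Set V} {x y : V} :
    y ∈ compIn G s x ↔ pathBetween G x y ⊆ s := hG.reachIn_iff

lemma SimpleGraph.IsTree.pathClosed_compIn (hG : G.IsTree) (s : Set V) (x : V) :
    PathClosed G (compIn G s x) := by
  intro u hu v hv y hy
  rw [hG.mem_compIn] at *
  rcases pathBetween_subset_union u x v hy with h | h
  · rw [pathBetween_comm] at h
    exact (pathBetween_subset_left h).trans hu
  · exact (pathBetween_subset_left h).trans hv

lemma compIn_subset {s : Set V} {x : V} : compIn G s x ⊆ s :=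
  fun _ ⟨p, hp⟩ => hp _ p.end_mem_support

lemma mem_compIn_self {s : Set V} {x : V} (hx : x ∈ s) : x ∈ compIn G s x :=
  ⟨.nil, by simpa⟩

lemma mem_compIn_of_mem_of_reachIn {s : Set V} {x y z : V} (hy : y ∈ compIn G s x)
    (hz : ReachIn G s y z) : z ∈ compIn G s x := by
  obtain ⟨p, hp⟩ := hy
  obtain ⟨q, hq⟩ := hz
  refine ⟨p.append q, fun v hv => ?_⟩
  rw [SimpleGraph.Walk.mem_support_append_iff] at hv
  exact hv.elim (hp v) (hq v)

lemma ReachIn.symm {s : Set V} {x y : V} (h : ReachIn G s x y) : ReachIn G s y x := by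
  obtain ⟨p, hp⟩ := h
  exact ⟨p.reverse, by simpa⟩

lemma compIn_eq_of_mem {s : Set V} {x y : V} (hy : y ∈ compIn G s x) :
    compIn G s y = compIn G s x := by
  ext z
  exact ⟨mem_compIn_of_mem_of_reachIn hy,
    mem_compIn_of_mem_of_reachIn (ReachIn.symm hy)⟩

end PathBetween

namespace RTree

lemma vertSet_node (r : V) (ts : List (RTree V)) :
    (node r ts).vertSet = insert r {v | ∃ t ∈ ts, v ∈ t.vertSet} := by
  ext v
  simp [vertSet, pathsFrom]
  grind

lemma mem_pathSet_node {r u v : V} {ts : List (RTree V)} :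
    u ∈ (node r ts).pathSet v ↔
      (v = r ∧ u = r) ∨ ∃ t ∈ ts, v ∈ t.vertSet ∧ (u = r ∨ u ∈ t.pathSet v) := by
  simp [vertSet, pathSet, pathsFrom]
  grind

lemma mem_allSubtrees_node {r : V} {ts : List (RTree V)} {t : RTree V} :
    t ∈ (node r ts).allSubtrees ↔ t = node r ts ∨ ∃ t' ∈ ts, t ∈ t'.allSubtrees := by
  simp [allSubtrees]

lemma root_mem_vertSet (T : RTree V) : T.root ∈ T.vertSet := by
  cases T
  simp [vertSet_node, root]

end RTree

namespace IsSearchTree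

variable {G : SimpleGraph V} {s : Set V} {T : RTree V}

lemma vertSet_eq (h : IsSearchTree G s T) : T.vertSet = s := by
  cases h
  assumption

lemma pathSet_subset (h : IsSearchTree G s T) (v : V) : T.pathSet v ⊆ s := by
  induction h with
  | @node s r ts hr hs ht _ ih =>
    intro u hu
    rw [RTree.mem_pathSet_node] at hu
    rcases hu with ⟨-, rfl⟩ | ⟨t, htm, -, rfl | hu⟩
    · exact hr
    · exact hr
    · exact (compIn_subset (ih t htm hu)).1

lemma pathSet_root {r : V} {ts : List (RTree V)} (h : IsSearchTree G s (.node r ts)) :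
    (RTree.node r ts).pathSet r = {r} := by
  cases h with
  | node hr hs ht hp =>
    ext u
    rw [RTree.mem_pathSet_node]
    constructor
    · rintro (h | ⟨t, htm, hrt, -⟩)
      · exact h.2
      · rw [(ht t htm).vertSet_eq] at hrt
        exact absurd rfl (compIn_subset hrt).2
    · rintro rfl
      simp

lemma pathSet_child {r v : V} {ts : List (RTree V)} {t : RTree V}
    (h : IsSearchTree G s (.node r ts)) (htm : t ∈ ts) (hv : v ∈ t.vertSet) :
    (RTree.node r ts).pathSet v = insert r (t.pathSet v) := by
  cases h with
  | node hr hs ht hp =>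
    have key : ∀ t' ∈ ts, v ∈ t'.vertSet → t' = t := by
      intro t' ht' hv'
      by_contra hne
      rw [(ht t htm).vertSet_eq] at hv
      rw [(ht t' ht').vertSet_eq] at hv'
      have hsymm : Std.Symm fun t₁ t₂ : RTree V =>
          compIn G (s \ {r}) t₁.root ≠ compIn G (s \ {r}) t₂.root := ⟨fun _ _ h => h.symm⟩
      exact hp.forall ht' htm hne ((compIn_eq_of_mem hv').symm.trans (compIn_eq_of_mem hv))
    have hvr : v ≠ r := by
      rw [(ht t htm).vertSet_eq] at hv
      exact (compIn_subset hv).2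
    ext u
    rw [RTree.mem_pathSet_node]
    simp only [hvr, false_and, false_or, Set.mem_insert_iff]
    constructor
    · rintro ⟨t', ht', hv', hu⟩
      rwa [key t' ht' hv'] at hu
    · exact fun hu => ⟨t, htm, hv, hu⟩

lemma depth_root {r : V} {ts : List (RTree V)} (h : IsSearchTree G s (.node r ts)) :
    (RTree.node r ts).depth r = 1 := by
  simp [RTree.depth, h.pathSet_root]

variable [Finite V]

lemma depth_child {r v : V} {ts : List (RTree V)} {t : RTree V}
    (h : IsSearchTree G s (.node r ts)) (htm : t ∈ ts) (hv : v ∈ t.vertSet) :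
    (RTree.node r ts).depth v = t.depth v + 1 := by
  rw [RTree.depth, h.pathSet_child htm hv, Set.ncard_insert_of_notMem, RTree.depth]
  cases h with
  | node hr hs ht hp =>
    intro hrt
    exact (compIn_subset ((ht t htm).pathSet_subset v hrt)).2 rfl

lemma depth_pos (h : IsSearchTree G s T) {v : V} (hv : v ∈ s) : 1 ≤ T.depth v := by
  cases T with
  | node r ts =>
    rw [← h.vertSet_eq, RTree.vertSet_node] at hv
    rcases hv with rfl | ⟨t, htm, hv⟩
    · exact h.depth_root.ge
    · rw [h.depth_child htm hv]
      omega

/-- If all vertices on the path from `u` to `v` have depth at least that of `u ≠ r`, then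
`u` and `v` lie in the same child subtree. -/
lemma pathBetween_subset_child {r u v : V} {ts : List (RTree V)} {t : RTree V}
    (hG : G.IsTree) (h : IsSearchTree G s (.node r ts)) (hs : PathClosed G s)
    (htm : t ∈ ts) (hut : u ∈ t.vertSet) (hv : v ∈ s)
    (H : ∀ y ∈ pathBetween G u v, (RTree.node r ts).depth u ≤ (RTree.node r ts).depth y) :
    pathBetween G u v ⊆ t.vertSet := by
  have hru : r ∉ pathBetween G u v := by
    intro hr
    have h1 := H r hr
    rw [h.depth_root, h.depth_child htm hut] at h1
    cases h with
    | node hr hs ht hp =>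
      rw [(ht t htm).vertSet_eq] at hut
      have := (ht t htm).depth_pos hut
      omega
  cases h with
  | node hr hvs ht hp =>
    rw [(ht t htm).vertSet_eq] at hut ⊢
    have hsub : pathBetween G u v ⊆ s \ {r} := fun y hy =>
      ⟨hs u (compIn_subset hut).1 v hv hy, fun hyr => hru (hyr ▸ hy)⟩
    exact hG.pathClosed_compIn _ _ u hut v
      (mem_compIn_of_mem_of_reachIn hut (hG.reachIn_iff.2 hsub))

lemma mem_pathSet_of_depth_le (hG : G.IsTree) (h : IsSearchTree G s T) (hs : PathClosed G s)
    {u v : V} (hu : u ∈ s) (hv : v ∈ s) (H : ∀ y ∈ pathBetween G u v, T.depth u ≤ T.depth y) :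
    u ∈ T.pathSet v := by
  induction h generalizing u v with
  | @node s r ts hr hvs ht hp ih =>
    have h : IsSearchTree G s (.node r ts) := .node hr hvs ht hp
    rw [← hvs, RTree.vertSet_node] at hu hv
    rcases hu with rfl | ⟨t, htm, hut⟩
    · rw [RTree.mem_pathSet_node]
      rcases hv with rfl | ⟨t, htm, hv⟩
      · simp
      · exact Or.inr ⟨t, htm, hv, Or.inl rfl⟩
    · have hsub := h.pathBetween_subset_child hG hs htm hut
        (by rwa [← hvs, RTree.vertSet_node]) H
      have hvt := hsub (right_mem_pathBetween u v)
      rw [h.pathSet_child htm hvt]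
      right
      have hvs' := (ht t htm).vertSet_eq
      refine ih t htm (hG.pathClosed_compIn _ _) (hvs' ▸ hut) (hvs' ▸ hvt) fun y hy => ?_
      have := H y hy
      rw [h.depth_child htm hut, h.depth_child htm (hsub hy)] at this
      omega

lemma vertSet_of_mem_allSubtrees (hG : G.IsTree) (h : IsSearchTree G s T)
    (hs : PathClosed G s) {t : RTree V} (ht : t ∈ T.allSubtrees) :
    t.vertSet = {v ∈ s | ∀ y ∈ pathBetween G t.root v, T.depth t.root ≤ T.depth y} := by
  induction h with
  | @node s r ts hr hvs hts hp ih =>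
    have h : IsSearchTree G s (.node r ts) := .node hr hvs hts hp
    rw [RTree.mem_allSubtrees_node] at ht
    rcases ht with rfl | ⟨t', htm, ht⟩
    · rw [hvs]
      ext v
      simp only [Set.mem_ofPred_eq, RTree.root, h.depth_root]
      exact ⟨fun hv => ⟨hv, fun y hy => h.depth_pos (hs r hr v hv hy)⟩, And.left⟩
    · have hvt' := (hts t' htm).vertSet_eq
      have IH := ih t' htm (hG.pathClosed_compIn _ _) ht
      rw [← hvt'] at IH
      have hroot : t.root ∈ t'.vertSet := (IH ▸ t.root_mem_vertSet).1
      rw [IH]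
      ext v
      simp only [Set.mem_ofPred_eq]
      constructor
      · rintro ⟨hv, H⟩
        refine ⟨?_, fun y hy => ?_⟩
        · rw [hvt'] at hv
          exact (compIn_subset hv).1
        · have hy' : y ∈ t'.vertSet := by
            rw [hvt'] at hroot hv ⊢
            exact hG.pathClosed_compIn _ _ _ hroot _ hv hy
          rw [h.depth_child htm hroot, h.depth_child htm hy']
          have := H y hy
          omega
      · rintro ⟨hv, H⟩
        have hsub := h.pathBetween_subset_child hG hs htm hroot hv H
        refine ⟨hsub (right_mem_pathBetween _ _), fun y hy => ?_⟩
        have := H y hy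
        rw [h.depth_child htm hroot, h.depth_child htm (hsub hy)] at this
        omega

end IsSearchTree

/-- Repeatedly removing a vertex of minimum rank yields a search tree. -/
lemma SimpleGraph.IsTree.exists_isSearchTree [Finite V] {G : SimpleGraph V} (hG : G.IsTree)
    (f : V → ℕ) (s : Set V) (hne : s.Nonempty) (hs : PathClosed G s) :
    ∃ T, IsSearchTree G s T ∧ ∀ v ∈ s, T.pathSet v ⊆ ancestors G f v := by
  induction hn : s.ncard using Nat.strong_induction_on generalizing s with
  | _ n ih =>
  obtain ⟨r, hr, hmin⟩ := Set.exists_min_image s f s.toFinite hne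
  have hcomp : ∀ C ∈ comps G (s \ {r}), ∃ T, IsSearchTree G C T ∧
      ∀ v ∈ C, T.pathSet v ⊆ ancestors G f v := by
    rintro C ⟨x, hx, rfl⟩
    refine ih _ ?_ _ ⟨x, mem_compIn_self hx⟩ (hG.pathClosed_compIn _ _) rfl
    rw [← hn]
    refine Set.ncard_lt_ncard ⟨compIn_subset.trans Set.sdiff_subset, fun h => ?_⟩ s.toFinite
    exact (compIn_subset (h hr)).2 rfl
  have : Nonempty (RTree V) := ⟨.node r []⟩
  choose! F hF hFanc using hcomp
  have hroot : ∀ C ∈ comps G (s \ {r}), compIn G (s \ {r}) (F C).root = C := by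
    intro C hC
    have h := (hF C hC).vertSet_eq ▸ (F C).root_mem_vertSet
    obtain ⟨x, hx, rfl⟩ := hC
    exact compIn_eq_of_mem h
  set L := (comps G (s \ {r})).toFinite.toFinset.toList with hL
  have hmem : ∀ C, C ∈ L ↔ C ∈ comps G (s \ {r}) := by simp [hL]
  have hT : IsSearchTree G s (.node r (L.map F)) := by
    refine .node hr ?_ ?_ ?_
    · rw [RTree.vertSet_node]
      ext v
      simp only [List.mem_map, exists_exists_and_eq_and, Set.mem_insert_iff, Set.mem_ofPred_eq,
        hmem]
      constructor
      · rintro (rfl | ⟨C, hC, hv⟩)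
        · exact hr
        · rw [(hF C hC).vertSet_eq] at hv
          obtain ⟨x, hx, rfl⟩ := hC
          exact (compIn_subset hv).1
      · intro hv
        by_cases hvr : v = r
        · exact Or.inl hvr
        · have hC : compIn G (s \ {r}) v ∈ comps G (s \ {r}) := ⟨v, ⟨hv, hvr⟩, rfl⟩
          refine Or.inr ⟨_, hC, ?_⟩
          rw [(hF _ hC).vertSet_eq]
          exact mem_compIn_self ⟨hv, hvr⟩
    · simp only [List.mem_map, hmem]
      rintro _ ⟨C, hC, rfl⟩
      rw [hroot C hC]
      exact hF C hC
    · rw [List.pairwise_map]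
      refine (Finset.nodup_toList _).imp_of_mem fun {C D} hC hD hne => ?_
      rwa [hroot C ((hmem C).1 hC), hroot D ((hmem D).1 hD)]
  refine ⟨_, hT, fun v hv u hu => ?_⟩
  have huse := hs u (hT.pathSet_subset v hu) v hv
  rw [RTree.mem_pathSet_node] at hu
  have hrv : u = r → u ∈ ancestors G f v := by
    rintro rfl y hy
    exact hmin y (huse hy)
  rcases hu with ⟨-, hu⟩ | ⟨t, ht, hvt, hu | hu⟩
  · exact hrv hu
  · exact hrv hu
  · simp only [List.mem_map, hmem] at ht
    obtain ⟨C, hC, rfl⟩ := ht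
    rw [(hF C hC).vertSet_eq] at hvt
    exact hFanc C hC v hvt hu

section Lift

variable {G : SimpleGraph V} {f : V → ℕ} {r p : V}

/-- Move the rank of `p` to just below that of `r`, keeping the order of the other ranks. -/
def liftRank [DecidableEq V] (f : V → ℕ) (r p : V) : V → ℕ :=
  fun y => if y = p then 2 * f r else 2 * f y + 1

variable [DecidableEq V]

lemma mem_ancestors_of_mem_liftRank {u v : V} (hp : f r ≤ f p) (hu : u ≠ p)
    (h : u ∈ ancestors G (liftRank f r p) v) : u ∈ ancestors G f v := by
  intro y hy
  have := h y hy
  simp only [liftRank, hu, if_false] at this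
  split_ifs at this with hyp
  · subst hyp
    omega
  · omega

lemma lt_of_mem_ancestors_liftRank {u v : V} (hu : u ≠ p)
    (h : u ∈ ancestors G (liftRank f r p) v) (hpuv : p ∈ pathBetween G u v) : f u < f r := by
  have := h p hpuv
  simp only [liftRank, hu, if_false, if_true] at this
  omega

lemma ancestors_liftRank_of_notMem {v : V} (hp : r ∈ ancestors G f p)
    (hv : r ∉ ancestors G f v) : ancestors G (liftRank f r p) v ⊆ ancestors G f v := by
  have hrp : f r ≤ f p := hp p (right_mem_pathBetween _ _)
  intro u hu
  by_cases hup : u = p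
  · subst hup
    refine absurd (fun y hy => ?_) hv
    rcases pathBetween_subset_union r u v hy with h | h
    · exact hp y h
    · have hle := hu y h
      simp only [liftRank, if_true] at hle
      split_ifs at hle with hyu
      · exact hyu ▸ hrp
      · omega
  · exact mem_ancestors_of_mem_liftRank hrp hup hu

variable [Finite V]

/-- Lifting `p` separates `v` from the ancestors in `D`. -/
lemma ncard_ancestors_liftRank_add_le {v : V} (hp : f r ≤ f p) {D : Set V}
    (hD : D ⊆ ancestors G f v) (hDr : ∀ u ∈ D, u ≠ p ∧ f r ≤ f u ∧ p ∈ pathBetween G u v) :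
    (ancestors G (liftRank f r p) v).ncard + D.ncard ≤ (insert p (ancestors G f v)).ncard := by
  rw [← Set.ncard_union_eq _ (Set.toFinite _) (Set.toFinite _)]
  · refine Set.ncard_le_ncard (Set.union_subset (fun u hu => ?_) ?_) (Set.toFinite _)
    · by_cases hup : u = p
      · exact Or.inl hup
      · exact Or.inr (mem_ancestors_of_mem_liftRank hp hup hu)
    · exact hD.trans (Set.subset_insert _ _)
  · rw [Set.disjoint_left]
    intro u hu hu'
    obtain ⟨h1, h2, h3⟩ := hDr u hu'
    exact (lt_of_mem_ancestors_liftRank h1 hu h3).not_ge h2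

end Lift

/-- The total weight of `s` is the sum of the weights restricted to `s`. -/
lemma wsum_eq_sum_indicator [Fintype V] (w : V → ℝ) (s : Set V) :
    wsum w s = ∑ v, s.indicator w v := by
  rw [wsum, finsum_mem_def, finsum_eq_sum_of_fintype]

open Classical in
lemma sum_le_of_ncard_le [Fintype V] {G : SimpleGraph V} {w : V → ℝ} (hw : ∀ x, 0 ≤ w x)
    {f g : V → ℕ} {S A : Set V}
    (hopt : ∑ v, w v * ((ancestors G f v).ncard : ℝ) ≤
      ∑ v, w v * ((ancestors G g v).ncard : ℝ))
    (h : ∀ v, (ancestors G g v).ncard + (if v ∈ A then 1 else 0) ≤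
      (ancestors G f v).ncard + (if v ∈ S then 1 else 0)) :
    wsum w A ≤ wsum w S := by
  rw [wsum_eq_sum_indicator, wsum_eq_sum_indicator]
  have : ∑ v, (w v * ((ancestors G g v).ncard : ℝ) + A.indicator w v) ≤
      ∑ v, (w v * ((ancestors G f v).ncard : ℝ) + S.indicator w v) := by
    refine Finset.sum_le_sum fun v _ => ?_
    have h1 : ((ancestors G g v).ncard : ℝ) + (if v ∈ A then 1 else 0) ≤
      (ancestors G f v).ncard + (if v ∈ S then 1 else 0) := by exact_mod_cast h v
    have h2 := mul_le_mul_of_nonneg_left h1 (hw v)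
    simpa [mul_add, Set.indicator_apply] using h2
  rw [Finset.sum_add_distrib, Finset.sum_add_distrib] at this
  linarith

lemma SimpleGraph.IsTree.wsum_compIn_le [Fintype V] {G : SimpleGraph V} (hG : G.IsTree)
    {w : V → ℝ} (hw : ∀ x, 0 ≤ w x) {f : V → ℕ}
    (hopt : ∀ g : V → ℕ, ∑ v, w v * ((ancestors G f v).ncard : ℝ) ≤
      ∑ v, w v * ((ancestors G g v).ncard : ℝ))
    (r : V) {s : Set V} (hs : s = {v | r ∈ ancestors G f v}) {x : V} (hx : x ∈ s \ {r}) :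
    wsum w (compIn G (s \ {r}) x) ≤ 2 / 3 * wsum w s := by
  classical
  set H := compIn G (s \ {r}) x with hH
  have hHs : H ⊆ s \ {r} := compIn_subset
  have hHc : PathClosed G H := hG.pathClosed_compIn _ _
  have hrs : ∀ v ∈ s, r ∈ ancestors G f v := fun v hv => by rwa [hs] at hv
  have hrle : ∀ v ∈ s, f r ≤ f v := fun v hv => hrs v hv v (right_mem_pathBetween _ _)
  obtain ⟨c, hc, hcmin⟩ := Set.exists_min_image H f H.toFinite ⟨x, mem_compIn_self hx⟩
  have hcs := hHs hc
  have hcr : r ≠ c := fun h => hcs.2 h.symm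
  have hcanc : ∀ v ∈ H, c ∈ ancestors G f v := fun v hv y hy => hcmin y (hHc c hc v hv hy)
  set A := {v ∈ H | c ∉ pathBetween G r v} with hA
  have hAH : A ⊆ H := fun v hv => hv.1
  have h1 : wsum w (H \ A) ≤ wsum w (s \ H) := by
    refine sum_le_of_ncard_le hw (hopt (liftRank f r c)) fun v => ?_
    by_cases hvs : v ∈ s
    swap
    · have hvH : v ∉ H := fun h => hvs (hHs h).1
      simp only [Set.mem_sdiff, hvH, hvs, false_and, if_false]
      have hv : r ∉ ancestors G f v := fun h => hvs (by rwa [hs])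
      exact Set.ncard_le_ncard (ancestors_liftRank_of_notMem (hrs c hcs.1) hv) (Set.toFinite _)
    by_cases hvH : v ∈ H
    swap
    · simp only [Set.mem_sdiff, hvH, hvs, false_and, if_false, not_false_eq_true, and_self,
        if_true]
      have := ncard_ancestors_liftRank_add_le (G := G) (v := v) (hrle c hcs.1)
        (Set.empty_subset _) (by simp)
      have h2 := Set.ncard_insert_le c (ancestors G f v)
      simp only [Set.ncard_empty] at this
      omega
    · have hins := Set.insert_eq_of_mem (hcanc v hvH)
      by_cases hcv : c ∈ pathBetween G r v
      · have := ncard_ancestors_liftRank_add_le (G := G) (v := v) (D := {r}) (hrle c hcs.1)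
          (by simpa using hrs v hvs) (by simpa using ⟨hcr, hcv⟩)
        rw [hins, Set.ncard_singleton] at this
        simpa [hA, hvH, hcv] using this
      · have := ncard_ancestors_liftRank_add_le (G := G) (v := v) (hrle c hcs.1)
          (Set.empty_subset _) (by simp)
        rw [hins, Set.ncard_empty] at this
        simpa [hA, hvH, hcv] using this
  have h2 : wsum w A ≤ wsum w (s \ H) := by
    rcases A.eq_empty_or_nonempty with hAe | hAne
    · rw [hAe, wsum, finsum_mem_empty]
      exact finsum_nonneg fun v => finsum_nonneg fun _ => hw v
    obtain ⟨d, hd, hdmin⟩ := Set.exists_min_image A f A.toFinite hAne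
    have hdanc : ∀ v ∈ A, d ∈ ancestors G f v := by
      refine fun v hv y hy => hdmin y ⟨hHc d hd.1 v hv.1 hy, fun hcy => ?_⟩
      rcases pathBetween_subset_union d r v hy with h | h
      · rw [pathBetween_comm] at h
        exact hd.2 (pathBetween_subset_left h hcy)
      · exact hv.2 (pathBetween_subset_left h hcy)
    obtain ⟨p, hprc, hprd, hpcd⟩ := hG.exists_median r c d
    have hpH : p ∈ H := hHc c hc d hd.1 hpcd
    have hps := hHs hpH
    have hpr : r ≠ p := fun h => hps.2 h.symm
    have hpc : c ≠ p := fun h => hd.2 (h ▸ hprd)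
    have hcd : c ≠ d := fun h => hd.2 (h ▸ right_mem_pathBetween _ _)
    have hrd : r ≠ d := fun h => (hHs hd.1).2 h.symm
    have hle := hrle p hps.1
    refine sum_le_of_ncard_le hw (hopt (liftRank f r p)) fun v => ?_
    by_cases hvs : v ∈ s
    swap
    · have hvA : v ∉ A := fun h => hvs (hHs h.1).1
      simp only [Set.mem_sdiff, hvA, hvs, false_and, if_false]
      have hv : r ∉ ancestors G f v := fun h => hvs (by rwa [hs])
      exact Set.ncard_le_ncard (ancestors_liftRank_of_notMem (hrs p hps.1) hv) (Set.toFinite _)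
    have hinsle := Set.ncard_insert_le p (ancestors G f v)
    by_cases hvH : v ∈ H
    swap
    · have hvA : v ∉ A := fun h => hvH h.1
      simp only [Set.mem_sdiff, hvA, hvH, hvs, if_false, not_false_eq_true, and_self, if_true]
      have := ncard_ancestors_liftRank_add_le (G := G) (v := v) hle (Set.empty_subset _) (by simp)
      simp only [Set.ncard_empty] at this
      omega
    simp only [Set.mem_sdiff, hvH, not_true, and_false, if_false]
    have hsep : ∀ a b, p ∈ pathBetween G a b → p ∈ pathBetween G a v ∨ p ∈ pathBetween G b v := by
      intro a b h
      rw [pathBetween_comm b v]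
      exact pathBetween_subset_union a v b h
    have hone : ∀ a ∈ ancestors G f v, a ≠ p → f r ≤ f a → p ∈ pathBetween G a v →
        (ancestors G (liftRank f r p) v).ncard + 1 ≤ (insert p (ancestors G f v)).ncard := by
      intro a ha hap hra hpa
      have := ncard_ancestors_liftRank_add_le (G := G) (v := v) (D := {a}) hle
        (by simpa using ha) (by simpa using ⟨hap, hra, hpa⟩)
      rwa [Set.ncard_singleton] at this
    have hrc : (ancestors G (liftRank f r p) v).ncard + 1 ≤
        (insert p (ancestors G f v)).ncard := by
      rcases hsep r c hprc with h | h
      · exact hone r (hrs v hvs) hpr le_rfl h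
      · exact hone c (hcanc v hvH) hpc (hrle c hcs.1) h
    by_cases hvA : v ∈ A
    swap
    · simp only [hvA, if_false]
      omega
    simp only [hvA, if_true]
    by_cases hpd : d = p
    · rwa [Set.insert_eq_of_mem (hpd ▸ hdanc v hvA)] at hrc
    have htwo : ∀ a ∈ ancestors G f v, ∀ b ∈ ancestors G f v, a ≠ b → a ≠ p → b ≠ p →
        f r ≤ f a → f r ≤ f b → p ∈ pathBetween G a v → p ∈ pathBetween G b v →
        (ancestors G (liftRank f r p) v).ncard + 2 ≤ (insert p (ancestors G f v)).ncard := by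
      intro a ha b hb hab hap hbp hra hrb hpa hpb
      have := ncard_ancestors_liftRank_add_le (G := G) (v := v) (D := {a, b}) hle
        (by simp [Set.insert_subset_iff, ha, hb]) (by simp [*])
      rwa [Set.ncard_pair hab] at this
    have hr' := hrs v hvs
    have hc' := hcanc v hvH
    have hd' := hdanc v hvA
    have hrc' := hrle c hcs.1
    have hrd' := hrle d (hHs hd.1).1
    have : (ancestors G (liftRank f r p) v).ncard + 2 ≤
        (insert p (ancestors G f v)).ncard := by
      by_cases hrv : p ∈ pathBetween G r v
      · rcases hsep c d hpcd with h | h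
        · exact htwo r hr' c hc' hcr hpr hpc le_rfl hrc' hrv h
        · exact htwo r hr' d hd' hrd hpr hpd le_rfl hrd' hrv h
      · exact htwo c hc' d hd' hcd hpc hpd hrc' hrd' ((hsep r c hprc).resolve_left hrv)
          ((hsep r d hprd).resolve_left hrv)
    omega
  have hsum : ∀ {B C : Set V}, B ⊆ C → wsum w B + wsum w (C \ B) = wsum w C := by
    intro B C hBC
    rw [wsum, wsum, wsum, ← finsum_mem_union Set.disjoint_sdiff_right (Set.toFinite _)
      (Set.toFinite _), Set.union_sdiff_cancel hBC]
  have h3 := hsum hAH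
  have h4 := hsum (hHs.trans Set.sdiff_subset)
  linarith

lemma OPT_le_cost [Finite V] {G : SimpleGraph V} {w : V → ℝ} (hw : ∀ x, 0 ≤ w x) {s : Set V}
    {T : RTree V} (hT : IsSearchTree G s T) : OPT G w s ≤ cost w T := by
  refine csInf_le ⟨0, ?_⟩ ⟨T, hT, rfl⟩
  rintro _ ⟨T', -, rfl⟩
  exact finsum_nonneg fun v => finsum_nonneg fun _ => mul_nonneg (hw v) (Nat.cast_nonneg _)

lemma IsSearchTree.cost_eq_sum [Fintype V] {G : SimpleGraph V} (w : V → ℝ) {T : RTree V}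
    (hT : IsSearchTree G Set.univ T) : cost w T = ∑ v, w v * (T.depth v : ℝ) := by
  rw [cost, hT.vertSet_eq, finsum_mem_univ, finsum_eq_sum_of_fintype]

theorem optimal_is_two_thirds_centroid {V : Type} [Fintype V]
    (G : SimpleGraph V) (hG : G.IsTree) (w : V → ℝ) (hw : ∀ x, 0 ≤ w x)
    (T : RTree V) (hT : IsSearchTree G Set.univ T)
    (hopt : cost w T = OPT G w Set.univ) :
    IsAlphaCentroidTree G w (2 / 3) Set.univ T := by
  have huniv : PathClosed G Set.univ := fun _ _ _ _ => Set.subset_univ _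
  have hne : (Set.univ : Set V).Nonempty := ⟨T.root, trivial⟩
  refine ⟨hT, fun t ht => ⟨t.root_mem_vertSet, fun x hx => ?_⟩⟩
  refine hG.wsum_compIn_le hw (f := T.depth) (fun g => ?_) t.root ?_ hx
  · obtain ⟨T', hT', hanc⟩ := hG.exists_isSearchTree g _ hne huniv
    calc ∑ v, w v * ((ancestors G T.depth v).ncard : ℝ)
        ≤ ∑ v, w v * (T.depth v : ℝ) := by
          refine Finset.sum_le_sum fun v _ => mul_le_mul_of_nonneg_left ?_ (hw v)
          exact_mod_cast Set.ncard_le_ncard (fun u hu =>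
            hT.mem_pathSet_of_depth_le hG huniv trivial trivial hu) (Set.toFinite _)
      _ = cost w T := (hT.cost_eq_sum w).symm
      _ ≤ cost w T' := hopt.trans_le (OPT_le_cost hw hT')
      _ = ∑ v, w v * (T'.depth v : ℝ) := hT'.cost_eq_sum w
      _ ≤ ∑ v, w v * ((ancestors G g v).ncard : ℝ) := by
          refine Finset.sum_le_sum fun v _ => mul_le_mul_of_nonneg_left ?_ (hw v)
          exact_mod_cast Set.ncard_le_ncard (hanc v trivial) (Set.toFinite _)
  · rw [hT.vertSet_of_mem_allSubtrees hG huniv ht]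
    simp [ancestors]
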